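/- arXiv:hep-th/0306169 — 6 statements merged into one kernel-verified Lean document; each statement's English description precedes it below -/
import Mathlib

section
/- Fix m > 0 and β > 0. The function h : ℝ × ℝ³ → ℂ defined by h(t, x) = ∫_{ℝ³} (N(ω(k)) / (2 ω(k))) · (exp(−i(ω(k)t − ⟨k, x⟩)) + exp(i(ω(k)t − ⟨k, x⟩))) dk (the sum G⁺_mat + G⁻_mat of the two temperature-dependent pieces of the contour-ordered propagator at real times) is well-defined (the integrand is Lebesgue integrable for every (t,x)) and is infinitely differentiable (C^∞) on ℝ × ℝ³. In particular, the temperature-dependent part of the finite-temperature propagator is a smooth function, so only the temperature-independent vacuum part can contribute singularities. -/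
open MeasureTheory RealInnerProductSpace

open Complex in
/-- An oscillatory integral whose density has finite moments of every order is a smooth function
of the parameter in which its phase is linear. -/
theorem contDiff_integral_mul_exp_of_integrable_moments {α V W : Type*} [MeasurableSpace α]
    {μ : Measure α} [NormedAddCommGroup V] [NormedSpace ℝ V] [MeasurableSpace V] [BorelSpace V]
    [SecondCountableTopology V] [NormedAddCommGroup W] [NormedSpace ℝ W]
    (L : V →L[ℝ] W →L[ℝ] ℝ) {φ : α → V} (hφ : Measurable φ) {g : V → ℂ} (hg : Measurable g)
    (hint : ∀ n : ℕ, Integrable (fun a => ‖φ a‖ ^ n * ‖g (φ a)‖) μ) :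
    ContDiff ℝ (⊤ : ℕ∞) (fun w => ∫ a, g (φ a) * cexp (-I * (L (φ a) w : ℝ)) ∂μ) := by
  suffices h : (fun w => ∫ a, g (φ a) * cexp (-I * (L (φ a) w : ℝ)) ∂μ) =
      VectorFourier.fourierIntegral Real.fourierChar (μ.map φ)
        (((2 * Real.pi)⁻¹ : ℝ) • L).toLinearMap₁₂ g by
    rw [h]
    exact VectorFourier.contDiff_fourierIntegral _ fun n _ =>
      (integrable_map_measure (by fun_prop) hφ.aemeasurable).2 (hint n)
  funext w
  have hL : Measurable fun v => L v w := by
    have : Continuous fun v => L v w := by fun_prop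
    exact this.measurable
  have hexp (x : ℝ) : (Real.fourierChar (-((2 * Real.pi)⁻¹ * x)) : ℂ) = cexp (-I * x) := by
    rw [Real.fourierChar_apply]
    congr 1
    push_cast
    have : (Real.pi : ℂ) ≠ 0 := mod_cast Real.pi_ne_zero
    field_simp
  change _ = ∫ v, Real.fourierChar (-((2 * Real.pi)⁻¹ * L v w)) • g v ∂(μ.map φ)
  simp only [Circle.smul_def, smul_eq_mul, hexp]
  rw [integral_map hφ.aemeasurable (by fun_prop)]
  simp only [mul_comm]

/-- The Bose–Einstein weight `N(E) / (2 E)` decays faster than any power of the energy. -/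
theorem exists_one_add_pow_mul_boseEinstein_le {m β : ℝ} (hm : 0 < m) (hβ : 0 < β) (n : ℕ) :
    ∃ C : ℝ, ∀ E, m ≤ E → (1 + E) ^ n * |1 / (Real.exp (β * E) - 1) / (2 * E)| ≤ C := by
  have hc : 0 < 1 - Real.exp (-(β * m)) := by
    rw [sub_pos, Real.exp_lt_one_iff]
    exact neg_lt_zero.2 (mul_pos hβ hm)
  refine ⟨n.factorial / β ^ n * Real.exp β / ((1 - Real.exp (-(β * m))) * (2 * m)),
    fun E hE => ?_⟩
  have hE0 : 0 < E := hm.trans_le hE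
  have hpow : (1 + E) ^ n ≤ n.factorial / β ^ n * Real.exp β * Real.exp (β * E) := by
    have h := Real.pow_div_factorial_le_exp (β * (1 + E)) (by positivity) n
    rw [mul_add, mul_one, Real.exp_add, ← mul_one_add, mul_pow,
      div_le_iff₀ (by positivity)] at h
    rw [mul_assoc, div_mul_eq_mul_div, le_div_iff₀ (by positivity)]
    linarith
  have hden : (1 - Real.exp (-(β * m))) * Real.exp (β * E) ≤ Real.exp (β * E) - 1 := by
    have h : 1 ≤ Real.exp (-(β * m)) * Real.exp (β * E) := by
      rw [← Real.exp_add, Real.one_le_exp_iff]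
      nlinarith
    linarith
  have hpos : 0 < Real.exp (β * E) - 1 := (mul_pos hc (Real.exp_pos _)).trans_le hden
  rw [abs_of_pos (by positivity), div_div, mul_one_div, div_le_div_iff₀ (by positivity)
    (by positivity)]
  calc (1 + E) ^ n * ((1 - Real.exp (-(β * m))) * (2 * m))
      ≤ n.factorial / β ^ n * Real.exp β * Real.exp (β * E) *
        ((1 - Real.exp (-(β * m))) * (2 * E)) := by gcongr
    _ = n.factorial / β ^ n * Real.exp β *
        ((1 - Real.exp (-(β * m))) * Real.exp (β * E) * (2 * E)) := by ring
    _ ≤ n.factorial / β ^ n * Real.exp β * ((Real.exp (β * E) - 1) * (2 * E)) := by gcongr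

/-- All moments of the thermal density on the mass shell `k ↦ (ω(k), k)` are finite. -/
theorem integrable_massShell_norm_pow_mul_boseEinstein {V : Type*} [NormedAddCommGroup V]
    [NormedSpace ℝ V] [FiniteDimensional ℝ V] [MeasurableSpace V] [BorelSpace V]
    (μ : Measure V) [μ.IsAddHaarMeasure] {m β : ℝ} (hm : 0 < m) (hβ : 0 < β) (n : ℕ) :
    Integrable (fun k : V => ‖(√(‖k‖ ^ 2 + m ^ 2), k)‖ ^ n *
      |1 / (Real.exp (β * √(‖k‖ ^ 2 + m ^ 2)) - 1) / (2 * √(‖k‖ ^ 2 + m ^ 2))|) μ := by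
  obtain ⟨d, hd⟩ : ∃ d, d = Module.finrank ℝ V + 1 := ⟨_, rfl⟩
  obtain ⟨C, hC⟩ := exists_one_add_pow_mul_boseEinstein_le hm hβ (n + d)
  have hdom : Integrable (fun k : V => (1 + ‖k‖) ^ (-(d : ℝ))) μ :=
    integrable_one_add_norm (by rw [hd]; push_cast; linarith)
  refine (hdom.const_mul C).mono' (by fun_prop) (.of_forall fun k => ?_)
  have hmω : m ≤ √(‖k‖ ^ 2 + m ^ 2) := Real.le_sqrt_of_sq_le (by nlinarith [sq_nonneg ‖k‖])
  have hkω : ‖k‖ ≤ √(‖k‖ ^ 2 + m ^ 2) := Real.le_sqrt_of_sq_le (by nlinarith [sq_nonneg m])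
  specialize hC _ hmω
  generalize √(‖k‖ ^ 2 + m ^ 2) = ω at hmω hkω hC ⊢
  have hω : 0 < ω := hm.trans_le hmω
  have hv : ‖(ω, k)‖ ≤ 1 + ω := by
    rw [Prod.norm_mk, Real.norm_of_nonneg hω.le]
    exact max_le (by linarith) (by linarith)
  rw [Real.norm_of_nonneg (by positivity), Real.rpow_neg (by positivity), Real.rpow_natCast,
    ← div_eq_mul_inv, le_div_iff₀ (by positivity)]
  refine le_trans ?_ hC
  rw [pow_add, mul_right_comm]
  gcongr

/-- For `m > 0` and `β > 0`, the sum of the two temperature-dependent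
(matter) pieces of the contour-ordered propagator at real times,
`h(t,x) = ∫ (N(ω k)/(2 ω k)) (exp(−i(ω k · t − ⟨k,x⟩)) + exp(i(ω k · t − ⟨k,x⟩))) dk`,
has a Lebesgue integrable integrand for every `(t,x)` and defines a `C^∞` function
on `ℝ × ℝ³`. -/
theorem matter_piece_sum_integrable_and_smooth (m β : ℝ) (hm : 0 < m) (hβ : 0 < β) :
    (∀ (t : ℝ) (x : EuclideanSpace ℝ (Fin 3)),
      Integrable (fun k : EuclideanSpace ℝ (Fin 3) =>
        (((1 / (Real.exp (β * Real.sqrt (‖k‖ ^ 2 + m ^ 2)) - 1)) /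
            (2 * Real.sqrt (‖k‖ ^ 2 + m ^ 2)) : ℝ) : ℂ) *
          (Complex.exp (-Complex.I * ((Real.sqrt (‖k‖ ^ 2 + m ^ 2) * t - ⟪k, x⟫ : ℝ) : ℂ)) +
           Complex.exp (Complex.I * ((Real.sqrt (‖k‖ ^ 2 + m ^ 2) * t - ⟪k, x⟫ : ℝ) : ℂ))))) ∧
    ContDiff ℝ (⊤ : ℕ∞) (fun p : ℝ × EuclideanSpace ℝ (Fin 3) =>
      ∫ k : EuclideanSpace ℝ (Fin 3),
        (((1 / (Real.exp (β * Real.sqrt (‖k‖ ^ 2 + m ^ 2)) - 1)) /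
            (2 * Real.sqrt (‖k‖ ^ 2 + m ^ 2)) : ℝ) : ℂ) *
          (Complex.exp (-Complex.I * ((Real.sqrt (‖k‖ ^ 2 + m ^ 2) * p.1 - ⟪k, p.2⟫ : ℝ) : ℂ)) +
           Complex.exp (Complex.I * ((Real.sqrt (‖k‖ ^ 2 + m ^ 2) * p.1 - ⟪k, p.2⟫ : ℝ) : ℂ)))) := by
  set V := EuclideanSpace ℝ (Fin 3)
  let φ : V → ℝ × V := fun k => (√(‖k‖ ^ 2 + m ^ 2), k)
  let g : ℝ × V → ℂ := fun v => ((1 / (Real.exp (β * v.1) - 1) / (2 * v.1) : ℝ) : ℂ)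
  let B : V →L[ℝ] V →L[ℝ] ℝ := innerSL ℝ
  let L : ℝ × V →L[ℝ] ℝ × V →L[ℝ] ℝ :=
    (ContinuousLinearMap.mul ℝ ℝ).bilinearComp (.fst ℝ ℝ V) (.fst ℝ ℝ V) -
      B.bilinearComp (.snd ℝ ℝ V) (.snd ℝ ℝ V)
  have hφ : Measurable φ := by fun_prop
  have hg : Measurable g := by fun_prop
  have hmom (n : ℕ) : Integrable (fun k => ‖φ k‖ ^ n * ‖g (φ k)‖) := by
    simpa only [φ, g, Complex.norm_real, Real.norm_eq_abs] using
      integrable_massShell_norm_pow_mul_boseEinstein (V := V) volume hm hβ n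
  have hgφ : Integrable fun k => g (φ k) :=
    (integrable_norm_iff (hg.comp hφ).aestronglyMeasurable).1 (by simpa using hmom 0)
  have hmode (p : ℝ × V) (M : ℝ × V →L[ℝ] ℝ × V →L[ℝ] ℝ) :
      Integrable fun k => g (φ k) * Complex.exp (-Complex.I * (M (φ k) p : ℝ)) := by
    have hM : Measurable fun v => M v p := by
      have : Continuous fun v => M v p := by fun_prop
      exact this.measurable
    refine hgφ.mul_bdd (c := 1) (by fun_prop) (.of_forall fun k => ?_)
    simp [Complex.norm_exp]
  have hsum (t : ℝ) (x k : V) :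
      g (φ k) * (Complex.exp (-Complex.I * ((√(‖k‖ ^ 2 + m ^ 2) * t - ⟪k, x⟫ : ℝ) : ℂ)) +
        Complex.exp (Complex.I * ((√(‖k‖ ^ 2 + m ^ 2) * t - ⟪k, x⟫ : ℝ) : ℂ))) =
      g (φ k) * Complex.exp (-Complex.I * (L (φ k) (t, x) : ℝ)) +
        g (φ k) * Complex.exp (-Complex.I * ((-L) (φ k) (t, x) : ℝ)) := by
    have hL : L (φ k) (t, x) = √(‖k‖ ^ 2 + m ^ 2) * t - ⟪k, x⟫ := rfl
    rw [neg_apply, neg_apply, hL, mul_add, Complex.ofReal_neg, neg_mul_neg]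
  constructor
  · intro t x
    exact ((hmode (t, x) L).add (hmode (t, x) (-L))).congr
      (.of_forall fun k => (hsum t x k).symm)
  · have h := (contDiff_integral_mul_exp_of_integrable_moments L hφ hg hmom).add
      (contDiff_integral_mul_exp_of_integrable_moments (-L) hφ hg hmom)
    convert h using 1
    ext p
    rw [← integral_add (hmode p L) (hmode p (-L))]
    exact integral_congr_ae (.of_forall fun k => hsum p.1 p.2 k)
end

section
/- Fix m > 0 and β > 0. The temperature-dependent matter piece G_mat(t, x) = ∫_{ℝ³} (N(ω(k)) / (2 ω(k))) · exp(−i(ω(k)t − ⟨k, x⟩)) dk is well-defined for every (t, x) ∈ ℝ × ℝ³ and defines an infinitely differentiable (C^∞) function on ℝ × ℝ³. -/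
open MeasureTheory RealInnerProductSpace

/-- The Bose–Einstein weight of the matter piece as a function of the energy. -/
noncomputable def boseWeight (β E : ℝ) : ℝ := (1 / (Real.exp (β * E) - 1)) / (2 * E)

lemma measurable_boseWeight (β : ℝ) : Measurable (boseWeight β) := by
  unfold boseWeight
  fun_prop

lemma pow_div_factorial_le_exp_sub_one {x : ℝ} (hx : 0 ≤ x) (n : ℕ) :
    x ^ (n + 1) / (n + 1).factorial ≤ Real.exp x - 1 := by
  have h := Real.sum_le_exp_of_nonneg hx (n + 2)
  rw [Finset.sum_range_succ] at h
  have h' : (1 : ℝ) ≤ ∑ i ∈ Finset.range (n + 1), x ^ i / i.factorial := by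
    simpa using Finset.single_le_sum (f := fun i : ℕ => x ^ i / (i.factorial : ℝ))
      (fun i _ => by positivity) (Finset.mem_range.2 n.succ_pos)
  linarith

lemma boseWeight_nonneg {β E : ℝ} (hβ : 0 < β) (hE : 0 < E) : 0 ≤ boseWeight β E := by
  have : 0 ≤ Real.exp (β * E) - 1 := sub_nonneg.2 (Real.one_le_exp (by positivity))
  unfold boseWeight
  positivity

lemma pow_mul_boseWeight_le {β E : ℝ} (hβ : 0 < β) (hE : 0 < E) (n : ℕ) :
    E ^ n * boseWeight β E ≤ (n + 3).factorial / (2 * β ^ (n + 3)) * (E ^ 4)⁻¹ := by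
  have h := pow_div_factorial_le_exp_sub_one (mul_pos hβ hE).le (n + 2)
  have hpos : 0 < (β * E) ^ (n + 2 + 1) / ((n + 2 + 1).factorial : ℝ) := by positivity
  calc E ^ n * boseWeight β E
      ≤ E ^ n * ((1 / ((β * E) ^ (n + 2 + 1) / ((n + 2 + 1).factorial : ℝ))) / (2 * E)) := by
        unfold boseWeight
        gcongr
    _ = (n + 3).factorial / (2 * β ^ (n + 3)) * (E ^ 4)⁻¹ := by
        rw [mul_pow]
        field_simp
        ring

section Dispersion

variable {V : Type*} [NormedAddCommGroup V]

/-- The relativistic energy `√(‖k‖² + m²)`. -/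
noncomputable def relEnergy (m : ℝ) (k : V) : ℝ := Real.sqrt (‖k‖ ^ 2 + m ^ 2)

lemma relEnergy_pos {m : ℝ} (hm : 0 < m) (k : V) : 0 < relEnergy m k :=
  Real.sqrt_pos.2 (by positivity)

lemma norm_le_relEnergy (m : ℝ) (k : V) : ‖k‖ ≤ relEnergy m k :=
  Real.le_sqrt_of_sq_le (by nlinarith [sq_nonneg m])

lemma le_relEnergy (m : ℝ) (k : V) : m ≤ relEnergy m k :=
  Real.le_sqrt_of_sq_le (by nlinarith [sq_nonneg ‖k‖])

lemma continuous_relEnergy (m : ℝ) : Continuous (relEnergy m : V → ℝ) := by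
  unfold relEnergy
  fun_prop

lemma one_add_norm_le_mul_relEnergy {m : ℝ} (hm : 0 < m) (k : V) :
    1 + ‖k‖ ≤ (m⁻¹ + 1) * relEnergy m k := by
  have h : m⁻¹ * m ≤ m⁻¹ * relEnergy m k := by
    gcongr
    exact le_relEnergy m k
  rw [inv_mul_cancel₀ hm.ne'] at h
  linarith [norm_le_relEnergy m k]

lemma norm_relEnergy_prodMk {m : ℝ} (hm : 0 < m) (k : V) :
    ‖(relEnergy m k, k)‖ = relEnergy m k := by
  rw [Prod.norm_mk, Real.norm_of_nonneg (relEnergy_pos hm k).le,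
    max_eq_left (norm_le_relEnergy m k)]

variable [NormedSpace ℝ V] [FiniteDimensional ℝ V] [MeasurableSpace V] [BorelSpace V]

lemma integrable_relEnergy_pow_mul_boseWeight {m β : ℝ} (hm : 0 < m) (hβ : 0 < β)
    (μ : Measure V) [μ.IsAddHaarMeasure] (hV : Module.finrank ℝ V < 4) (n : ℕ) :
    Integrable (fun k : V => relEnergy m k ^ n * boseWeight β (relEnergy m k)) μ := by
  have hint : Integrable (fun k : V => (1 + ‖k‖) ^ (-(4 : ℝ))) μ :=
    integrable_one_add_norm (by exact_mod_cast hV)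
  have hcont := continuous_relEnergy (V := V) m
  refine (hint.const_mul ((n + 3).factorial / (2 * β ^ (n + 3)) * (m⁻¹ + 1) ^ 4)).mono'
    ((hcont.measurable.pow_const n).mul
      ((measurable_boseWeight β).comp hcont.measurable)).aestronglyMeasurable
    (Filter.Eventually.of_forall fun k => ?_)
  have hE := relEnergy_pos hm k
  have hk : (0 : ℝ) < 1 + ‖k‖ := by positivity
  rw [Real.norm_of_nonneg (mul_nonneg (by positivity) (boseWeight_nonneg hβ hE))]
  refine (pow_mul_boseWeight_le hβ hE n).trans ?_
  rw [mul_assoc]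
  gcongr
  rw [Real.rpow_neg hk.le, ← div_eq_mul_inv, inv_eq_one_div,
    show (4 : ℝ) = ((4 : ℕ) : ℝ) by norm_num, Real.rpow_natCast,
    div_le_div_iff₀ (by positivity) (by positivity), one_mul, ← mul_pow]
  gcongr
  exact one_add_norm_le_mul_relEnergy hm k

end Dispersion

section Pairing

variable (V : Type*) [NormedAddCommGroup V] [InnerProductSpace ℝ V]

/-- The Minkowski pairing `(E, k), (t, x) ↦ E t - ⟪k, x⟫`, divided by `2π`. -/
noncomputable def minkowskiPairing : (ℝ × V) →L[ℝ] (ℝ × V) →L[ℝ] ℝ :=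
  (2 * Real.pi)⁻¹ •
    ((ContinuousLinearMap.mul ℝ ℝ).bilinearComp (.fst ℝ ℝ V) (.fst ℝ ℝ V) -
      (show V →L[ℝ] V →L[ℝ] ℝ from innerSL ℝ).bilinearComp (.snd ℝ ℝ V) (.snd ℝ ℝ V))

variable {V}

lemma minkowskiPairing_apply (v w : ℝ × V) :
    minkowskiPairing V v w = (2 * Real.pi)⁻¹ * (v.1 * w.1 - ⟪v.2, w.2⟫) := by
  simp [minkowskiPairing]
  rfl

lemma fourierChar_neg_minkowskiPairing (v w : ℝ × V) :
    (Real.fourierChar (-minkowskiPairing V v w) : ℂ) =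
      Complex.exp (-Complex.I * ((v.1 * w.1 - ⟪v.2, w.2⟫ : ℝ) : ℂ)) := by
  rw [Real.fourierChar_apply, minkowskiPairing_apply, mul_neg,
    mul_inv_cancel_left₀ Real.two_pi_pos.ne']
  push_cast
  ring_nf

end Pairing

/-- For `m > 0` and `β > 0`, the temperature-dependent matter piece
`G_mat(t,x) = ∫ (N(ω k)/(2 ω k)) exp(−i(ω k · t − ⟨k,x⟩)) dk` has a Lebesgue
integrable integrand for every `(t,x) ∈ ℝ × ℝ³` and defines a `C^∞` function. -/
theorem matter_piece_integrable_and_smooth (m β : ℝ) (hm : 0 < m) (hβ : 0 < β) :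
    (∀ (t : ℝ) (x : EuclideanSpace ℝ (Fin 3)),
      Integrable (fun k : EuclideanSpace ℝ (Fin 3) =>
        (((1 / (Real.exp (β * Real.sqrt (‖k‖ ^ 2 + m ^ 2)) - 1)) /
            (2 * Real.sqrt (‖k‖ ^ 2 + m ^ 2)) : ℝ) : ℂ) *
          Complex.exp (-Complex.I * ((Real.sqrt (‖k‖ ^ 2 + m ^ 2) * t - ⟪k, x⟫ : ℝ) : ℂ)))) ∧
    ContDiff ℝ (⊤ : ℕ∞) (fun p : ℝ × EuclideanSpace ℝ (Fin 3) =>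
      ∫ k : EuclideanSpace ℝ (Fin 3),
        (((1 / (Real.exp (β * Real.sqrt (‖k‖ ^ 2 + m ^ 2)) - 1)) /
            (2 * Real.sqrt (‖k‖ ^ 2 + m ^ 2)) : ℝ) : ℂ) *
          Complex.exp (-Complex.I * ((Real.sqrt (‖k‖ ^ 2 + m ^ 2) * p.1 - ⟪k, p.2⟫ : ℝ) : ℂ))) := by
  have hcont := continuous_relEnergy (V := EuclideanSpace ℝ (Fin 3)) m
  have hmeas := measurable_boseWeight β
  have hint := integrable_relEnergy_pow_mul_boseWeight (V := EuclideanSpace ℝ (Fin 3)) hm hβ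
    volume (by simp)
  refine ⟨fun t x => ?_, ?_⟩
  · have h0 : Integrable fun k : EuclideanSpace ℝ (Fin 3) =>
        ((boseWeight β (relEnergy m k) : ℝ) : ℂ) := by
      simpa using (hint 0).ofReal (𝕜 := ℂ)
    refine h0.mul_bdd (c := 1) (Continuous.aestronglyMeasurable (by fun_prop))
      (Filter.Eventually.of_forall fun k => ?_)
    rw [neg_mul, mul_comm, ← neg_mul, ← Complex.ofReal_neg, Complex.norm_exp_ofReal_mul_I]
  · set φ : EuclideanSpace ℝ (Fin 3) → ℝ × EuclideanSpace ℝ (Fin 3) :=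
      fun k => (relEnergy m k, k) with hφ
    have hφm : Measurable φ := hcont.measurable.prodMk measurable_id
    have hfm : Measurable fun v : ℝ × EuclideanSpace ℝ (Fin 3) => (boseWeight β v.1 : ℂ) :=
      Complex.measurable_ofReal.comp (hmeas.comp measurable_fst)
    have key := VectorFourier.contDiff_fourierIntegral (N := ⊤) (μ := Measure.map φ volume)
      (minkowskiPairing (EuclideanSpace ℝ (Fin 3)))
      (f := fun v => (boseWeight β v.1 : ℂ)) (fun n _ => by
        have hnm : Measurable fun v : ℝ × EuclideanSpace ℝ (Fin 3) =>
            ‖v‖ ^ n * ‖(boseWeight β v.1 : ℂ)‖ := (measurable_norm.pow_const n).mul hfm.norm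
        rw [integrable_map_measure hnm.aestronglyMeasurable hφm.aemeasurable]
        refine (hint n).congr (Filter.Eventually.of_forall fun k => ?_)
        simp [hφ, norm_relEnergy_prodMk hm,
          abs_of_nonneg (boseWeight_nonneg hβ (relEnergy_pos hm k))])
    have heq : VectorFourier.fourierIntegral Real.fourierChar (Measure.map φ volume)
        (minkowskiPairing (EuclideanSpace ℝ (Fin 3))).toLinearMap₁₂
        (fun v => (boseWeight β v.1 : ℂ)) = fun p => ∫ k : EuclideanSpace ℝ (Fin 3),
          (boseWeight β (relEnergy m k) : ℂ) *
            Complex.exp (-Complex.I * ((relEnergy m k * p.1 - ⟪k, p.2⟫ : ℝ) : ℂ)) := by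
      funext p
      have hpair : Continuous fun v : ℝ × EuclideanSpace ℝ (Fin 3) =>
          Complex.exp (-Complex.I * ((v.1 * p.1 - ⟪v.2, p.2⟫ : ℝ) : ℂ)) := by fun_prop
      have hprod : Measurable fun v : ℝ × EuclideanSpace ℝ (Fin 3) =>
          Complex.exp (-Complex.I * ((v.1 * p.1 - ⟪v.2, p.2⟫ : ℝ) : ℂ)) *
            (boseWeight β v.1 : ℂ) := hpair.measurable.mul hfm
      simp only [VectorFourier.fourierIntegral,
        ContinuousLinearMap.toLinearMap₁₂_apply_apply_apply,
        Circle.smul_def, fourierChar_neg_minkowskiPairing, smul_eq_mul]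
      rw [integral_map hφm.aemeasurable hprod.aestronglyMeasurable]
      exact integral_congr_ae (Filter.Eventually.of_forall fun k => mul_comm _ _)
    rw [heq] at key
    exact key
end

section
/- Fix m > 0 and β > 0. The function f : ℝ³ → ℝ given by f(k) = N(ω(k)) / (2 ω(k)) = 1 / (2 √(‖k‖² + m²) · (exp(β √(‖k‖² + m²)) − 1)) is a Schwartz function: it is C^∞ and every iterated derivative decays faster than any inverse power of ‖k‖ (i.e., f belongs to Schwartz space 𝒮(ℝ³, ℝ)). -/
open Function Set
open scoped ContDiff Nat

/-- The inverse of a function of temperate growth that is bounded below by a positive constant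
has temperate growth. -/
theorem Function.HasTemperateGrowth.inv_of_le {E : Type*} [NormedAddCommGroup E]
    [NormedSpace ℝ E] {f : E → ℝ} (hf : f.HasTemperateGrowth) {c : ℝ} (hc : 0 < c)
    (hcf : ∀ x, c ≤ f x) : (fun x ↦ (f x)⁻¹).HasTemperateGrowth := by
  have hpos : ∀ y ∈ Ioi (c / 2), 0 < y := fun y hy ↦ (half_pos hc).trans hy
  have hdiff : ContDiffOn ℝ ∞ (fun y : ℝ ↦ y⁻¹) (Ioi (c / 2)) :=
    contDiffOn_id.inv fun y hy ↦ (hpos y hy).ne'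
  refine HasTemperateGrowth.comp' (g := fun y : ℝ ↦ y⁻¹) (t := Ioi (c / 2)) ?_
    isOpen_Ioi.uniqueDiffOn hdiff ?_ hf
  · rintro - ⟨x, rfl⟩
    exact (half_lt_self hc).trans_le (hcf x)
  · intro N
    refine ⟨0, ∑ n ∈ Finset.range (N + 1), n ! * ((c / 2) ^ (n + 1))⁻¹, by positivity,
      fun n hn y hy ↦ ?_⟩
    rw [norm_iteratedFDerivWithin_eq_norm_iteratedDerivWithin,
      iteratedDerivWithin_of_isOpen isOpen_Ioi hy, iteratedDeriv_eq_iterate, iter_deriv_inv']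
    have hy0 := hpos y hy
    have key : ‖(-1 : ℝ) ^ n * n ! * y ^ (-1 - n : ℤ)‖ ≤ n ! * ((c / 2) ^ (n + 1))⁻¹ := by
      have h : (-1 - n : ℤ) = -((n + 1 : ℕ) : ℤ) := by push_cast; ring
      rw [h, zpow_neg, zpow_natCast, norm_mul, norm_mul, norm_pow, norm_neg, norm_one, one_pow,
        one_mul, Real.norm_natCast, Real.norm_of_nonneg (by positivity)]
      have : c / 2 ≤ y := le_of_lt hy
      gcongr
    rw [pow_zero, mul_one]
    exact key.trans (Finset.single_le_sum (f := fun n : ℕ ↦ (n ! : ℝ) * ((c / 2) ^ (n + 1))⁻¹)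
      (fun _ _ ↦ by positivity) (Finset.mem_range_succ_iff.2 hn))

/-- The exponential of a function of temperate growth that tends to `-∞` at least linearly
is a Schwartz function. -/
theorem Function.HasTemperateGrowth.exists_schwartzMap_exp {E : Type*} [NormedAddCommGroup E]
    [NormedSpace ℝ E] {u : E → ℝ} (hu : u.HasTemperateGrowth) {b : ℝ} (hb : 0 < b)
    (hub : ∀ x, u x ≤ -(b * ‖x‖)) : ∃ f : SchwartzMap E ℝ, ∀ x, f x = Real.exp (u x) := by
  refine ⟨⟨fun x ↦ Real.exp (u x), hu.1.exp, fun k n ↦ ?_⟩, fun x ↦ rfl⟩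
  obtain ⟨l, C, hC, hgrowth⟩ := hu.norm_iteratedFDeriv_le_uniform n
  set K := k + l * n
  refine ⟨n ! * (C + 1) ^ n * (K ! * Real.exp b / b ^ K), fun x ↦ ?_⟩
  have hexp : ∀ i ≤ n, ‖iteratedFDeriv ℝ i Real.exp (u x)‖ ≤ Real.exp (u x) := fun i _ ↦ by
    rw [norm_iteratedFDeriv_eq_norm_iteratedDeriv, iteratedDeriv_eq_iterate, Real.iter_deriv_exp,
      Real.norm_of_nonneg (Real.exp_pos _).le]
  have hD : ∀ i, 1 ≤ i → i ≤ n →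
      ‖iteratedFDeriv ℝ i u x‖ ≤ ((C + 1) * (1 + ‖x‖) ^ l) ^ i := fun i hi hin ↦ by
    have h1 : 1 ≤ (1 + ‖x‖) ^ l := one_le_pow₀ (by simp)
    calc ‖iteratedFDeriv ℝ i u x‖ ≤ C * (1 + ‖x‖) ^ l := hgrowth i hin x
      _ ≤ (C + 1) * (1 + ‖x‖) ^ l := by gcongr; simp
      _ ≤ _ := le_self_pow₀ (one_le_mul_of_one_le_of_one_le (by simpa) h1) (by lia)
  have hcomp := norm_iteratedFDeriv_comp_le (Real.contDiff_exp (n := ∞)) hu.1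
    (mod_cast le_top) x hexp hD
  have hdecay : (1 + ‖x‖) ^ K * Real.exp (u x) ≤ K ! * Real.exp b / b ^ K := by
    have h := Real.pow_div_factorial_le_exp (x := b * (1 + ‖x‖)) (by positivity) K
    rw [div_le_iff₀ (by positivity), mul_pow, mul_add, mul_one, Real.exp_add] at h
    rw [le_div_iff₀ (by positivity)]
    have h2 : Real.exp (b * ‖x‖) * Real.exp (u x) ≤ 1 := by
      rw [← Real.exp_add, Real.exp_le_one_iff]
      linarith [hub x]
    calc (1 + ‖x‖) ^ K * Real.exp (u x) * b ^ K
        = b ^ K * (1 + ‖x‖) ^ K * Real.exp (u x) := by ring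
      _ ≤ Real.exp b * Real.exp (b * ‖x‖) * K ! * Real.exp (u x) := by gcongr
      _ = K ! * Real.exp b * (Real.exp (b * ‖x‖) * Real.exp (u x)) := by ring
      _ ≤ K ! * Real.exp b := mul_le_of_le_one_right (by positivity) h2
  calc ‖x‖ ^ k * ‖iteratedFDeriv ℝ n (Real.exp ∘ u) x‖
      ≤ (1 + ‖x‖) ^ k * (n ! * Real.exp (u x) * ((C + 1) * (1 + ‖x‖) ^ l) ^ n) := by
        gcongr
        simp
    _ = n ! * (C + 1) ^ n * ((1 + ‖x‖) ^ K * Real.exp (u x)) := by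
        rw [mul_pow, ← pow_mul, pow_add]
        ring
    _ ≤ _ := by gcongr

/-- The relativistic energy `x ↦ √(‖x‖² + m²)` has temperate growth. -/
theorem hasTemperateGrowth_sqrt_norm_sq_add_sq {H : Type*} [NormedAddCommGroup H]
    [InnerProductSpace ℝ H] {m : ℝ} (hm : 0 < m) :
    (fun x : H ↦ √(‖x‖ ^ 2 + m ^ 2)).HasTemperateGrowth := by
  have h := (HasTemperateGrowth.const (E := H) m).mul
    ((hasTemperateGrowth_one_add_norm_sq_rpow H (1 / 2)).comp
      (m⁻¹ • ContinuousLinearMap.id ℝ H).hasTemperateGrowth)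
  refine (congrArg HasTemperateGrowth (funext fun x ↦ ?_)).mpr h
  have h1 : ‖x‖ ^ 2 + m ^ 2 = m ^ 2 * (1 + ‖m⁻¹ • x‖ ^ 2) := by
    rw [norm_smul, Real.norm_of_nonneg (by positivity)]
    field_simp
    ring
  rw [h1, Real.sqrt_mul (by positivity), Real.sqrt_sq hm.le, Real.sqrt_eq_rpow]
  simp

/-- For `m > 0` and `β > 0`, the function
`f(k) = N(ω k)/(2 ω k) = 1/(2 √(‖k‖² + m²) (exp(β √(‖k‖² + m²)) − 1))` on `ℝ³`
is a Schwartz function: there is a Schwartz map agreeing with it everywhere. -/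
theorem bose_einstein_symbol_is_schwartz (m β : ℝ) (hm : 0 < m) (hβ : 0 < β) :
    ∃ f : SchwartzMap (EuclideanSpace ℝ (Fin 3)) ℝ,
      ∀ k : EuclideanSpace ℝ (Fin 3),
        f k = 1 / (2 * Real.sqrt (‖k‖ ^ 2 + m ^ 2) *
          (Real.exp (β * Real.sqrt (‖k‖ ^ 2 + m ^ 2)) - 1)) := by
  have hE := hasTemperateGrowth_sqrt_norm_sq_add_sq (H := EuclideanSpace ℝ (Fin 3)) hm
  set E : EuclideanSpace ℝ (Fin 3) → ℝ := fun k ↦ √(‖k‖ ^ 2 + m ^ 2)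
  have h_mass_le : ∀ k, m ≤ E k := fun k ↦ Real.le_sqrt_of_sq_le (by nlinarith [sq_nonneg ‖k‖])
  have h_norm_le : ∀ k, ‖k‖ ≤ E k := fun k ↦ Real.le_sqrt_of_sq_le (by nlinarith [sq_nonneg m])
  obtain ⟨e, he⟩ := ((HasTemperateGrowth.const (-β)).mul hE).exists_schwartzMap_exp hβ
    (fun k ↦ by simpa using mul_le_mul_of_nonneg_left (h_norm_le k) hβ.le)
  simp only [Pi.mul_apply] at he
  have hem : ∀ k, e k ≤ Real.exp (-β * m) := fun k ↦ by
    rw [he, Real.exp_le_exp]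
    nlinarith [h_mass_le k]
  have hgap : Real.exp (-β * m) < 1 := by
    rw [Real.exp_lt_one_iff]
    nlinarith
  have hden : (fun k ↦ (1 - e k)⁻¹).HasTemperateGrowth :=
    HasTemperateGrowth.inv_of_le (f := fun k ↦ 1 - e k)
      ((HasTemperateGrowth.const (1 : ℝ)).sub (SchwartzMap.hasTemperateGrowth e))
      (sub_pos.2 hgap) fun k ↦ sub_le_sub_left (hem k) 1
  have hg : (fun k ↦ 1 / 2 * (E k)⁻¹ * (1 - e k)⁻¹).HasTemperateGrowth :=
    ((HasTemperateGrowth.const (1 / 2)).mul (hE.inv_of_le hm h_mass_le)).mul hden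
  refine ⟨SchwartzMap.smulLeftCLM ℝ (fun k ↦ 1 / 2 * (E k)⁻¹ * (1 - e k)⁻¹) e, fun k ↦ ?_⟩
  rw [SchwartzMap.smulLeftCLM_apply_apply hg]
  have hEk : 0 < E k := hm.trans_le (h_mass_le k)
  have hlt : 1 < Real.exp (β * E k) := Real.one_lt_exp_iff.2 (by positivity)
  have hexp : e k = (Real.exp (β * E k))⁻¹ := by rw [he, neg_mul, Real.exp_neg]
  change (1 / 2 * (E k)⁻¹ * (1 - e k)⁻¹) • e k = 1 / (2 * E k * (Real.exp (β * E k) - 1))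
  rw [hexp, smul_eq_mul]
  have h1 : Real.exp (β * E k) - 1 ≠ 0 := (sub_pos.2 hlt).ne'
  have h2 : 1 - (Real.exp (β * E k))⁻¹ ≠ 0 := (sub_pos.2 (inv_lt_one_of_one_lt₀ hlt)).ne'
  field_simp
end

section
/- Fix m > 0 and β > 0. For every fixed t ∈ ℝ, the spatial slice x ↦ G_mat(t, x) is a Schwartz function from ℝ³ to ℂ (it is C^∞ and all its derivatives decay faster than any inverse power of ‖x‖). -/
open MeasureTheory RealInnerProductSpace
open scoped ContDiff

namespace Function

/-- The derivative of a function of temperate growth has temperate growth. -/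
theorem HasTemperateGrowth.fderiv {E F : Type*} [NormedAddCommGroup E] [NormedSpace ℝ E]
    [NormedAddCommGroup F] [NormedSpace ℝ F] {f : E → F} (hf : f.HasTemperateGrowth) :
    (fderiv ℝ f).HasTemperateGrowth := by
  refine ⟨hf.1.fderiv_right (by simp), fun n ↦ ?_⟩
  obtain ⟨k, C, h⟩ := hf.2 (n + 1)
  exact ⟨k, C, fun x ↦ by simpa only [norm_iteratedFDeriv_fderiv] using h x⟩

/-- A solution of `φ' = φ ^ q • A` with smooth `A` is smooth. -/
theorem contDiff_of_hasFDerivAt_pow_smul {E : Type*} [NormedAddCommGroup E]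
    [NormedSpace ℝ E] {φ : E → ℂ} {A : E → E →L[ℝ] ℂ} {q : ℕ}
    (hφ : ∀ x, HasFDerivAt φ (φ x ^ q • A x) x) (hA : ContDiff ℝ ∞ A) : ContDiff ℝ ∞ φ := by
  rw [contDiff_infty]
  intro N
  induction N with
  | zero => exact contDiff_zero.2 (continuous_iff_continuousAt.2 fun x ↦ (hφ x).continuousAt)
  | succ N ih =>
    rw [Nat.cast_succ]
    exact contDiff_succ_iff_hasFDerivAt.2
      ⟨_, (ih.pow q).smul (hA.of_le (mod_cast le_top)), hφ⟩

/-- Let `φ` be of polynomial growth with `φ' = φ ^ (q + 1) • A` for some `A` of temperate growth.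
Then all derivatives of `φ ^ (j + 1) • G`, where `G` has temperate growth, are bounded by a
polynomial times `φ`. -/
theorem exists_norm_iteratedFDeriv_pow_smul_le {E : Type} [NormedAddCommGroup E]
    [NormedSpace ℝ E] {φ : E → ℂ} {A : E → E →L[ℝ] ℂ} {q : ℕ}
    (hφ : ∀ x, HasFDerivAt φ (φ x ^ (q + 1) • A x) x) (hA : A.HasTemperateGrowth)
    {k₀ : ℕ} {C₀ : ℝ} (hC₀ : ∀ x, ‖φ x‖ ≤ C₀ * (1 + ‖x‖) ^ k₀) (n : ℕ) :
    ∀ {F : Type} [NormedAddCommGroup F] [NormedSpace ℂ F] {G : E → F},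
      G.HasTemperateGrowth → ∀ j : ℕ, ∃ (k : ℕ) (C : ℝ), ∀ x,
        ‖iteratedFDeriv ℝ n (fun y ↦ φ y ^ (j + 1) • G y) x‖ ≤ C * (1 + ‖x‖) ^ k * ‖φ x‖ := by
  induction n with
  | zero =>
    intro F _ _ G hG j
    obtain ⟨k, C, h⟩ := hG.2 0
    refine ⟨k₀ * j + k, C₀ ^ j * C, fun x ↦ ?_⟩
    have h' := h x
    simp only [norm_iteratedFDeriv_zero] at h' ⊢
    calc ‖φ x ^ (j + 1) • G x‖ = ‖φ x‖ ^ j * ‖G x‖ * ‖φ x‖ := by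
          rw [norm_smul, norm_pow, pow_succ]; ring
      _ ≤ (C₀ * (1 + ‖x‖) ^ k₀) ^ j * (C * (1 + ‖x‖) ^ k) * ‖φ x‖ := by
          have := (norm_nonneg _).trans (hC₀ x)
          gcongr
          exact hC₀ x
      _ = _ := by rw [mul_pow, ← pow_mul, pow_add]; ring
  | succ n ih =>
    intro F _ _ G hG j
    let B : F →L[ℝ] (E →L[ℝ] ℂ) →L[ℝ] (E →L[ℝ] F) :=
      (ContinuousLinearMap.compL ℝ E ℂ F) ∘L (ContinuousLinearMap.lsmul ℝ ℂ).flip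
    have hH : (fun x ↦ ((j + 1 : ℕ) : ℂ) • B (G x) (A x)).HasTemperateGrowth :=
      (HasTemperateGrowth.const _).fun_smul (B.bilinear_hasTemperateGrowth hG hA)
    obtain ⟨k₁, C₁, h₁⟩ := ih hG.fderiv j
    obtain ⟨k₂, C₂, h₂⟩ := ih hH (j + q)
    have hderiv : _root_.fderiv ℝ (fun y ↦ φ y ^ (j + 1) • G y) =
        (fun y ↦ φ y ^ (j + 1) • _root_.fderiv ℝ G y) +
          fun y ↦ φ y ^ (j + q + 1) • (((j + 1 : ℕ) : ℂ) • B (G y) (A y)) := by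
      ext x v
      have hGx : HasFDerivAt G (_root_.fderiv ℝ G x) x :=
        ((hG.1.differentiable (by simp)) x).hasFDerivAt
      rw [(((hφ x).pow (j + 1)).fun_smul hGx).fderiv]
      simp [B, smul_smul]
      ring_nf
    have hφ' := contDiff_of_hasFDerivAt_pow_smul hφ hA.1
    have hs₁ : ContDiff ℝ n (fun y ↦ φ y ^ (j + 1) • _root_.fderiv ℝ G y) :=
      ((hφ'.pow _).smul hG.fderiv.1).of_le (mod_cast le_top)
    have hs₂ : ContDiff ℝ n (fun y ↦ φ y ^ (j + q + 1) • (((j + 1 : ℕ) : ℂ) • B (G y) (A y))) :=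
      ((hφ'.pow _).smul hH.1).of_le (mod_cast le_top)
    refine ⟨max k₁ k₂, |C₁| + |C₂|, fun x ↦ ?_⟩
    rw [← norm_iteratedFDeriv_fderiv, hderiv, iteratedFDeriv_add hs₁ hs₂]
    have h1 : 1 ≤ 1 + ‖x‖ := by simp
    calc _ ≤ _ := norm_add_le _ _
      _ ≤ C₁ * (1 + ‖x‖) ^ k₁ * ‖φ x‖ + C₂ * (1 + ‖x‖) ^ k₂ * ‖φ x‖ := add_le_add (h₁ x) (h₂ x)
      _ ≤ |C₁| * (1 + ‖x‖) ^ max k₁ k₂ * ‖φ x‖ + |C₂| * (1 + ‖x‖) ^ max k₁ k₂ * ‖φ x‖ := by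
          gcongr
          · exact le_abs_self _
          · exact le_max_left _ _
          · exact le_abs_self _
          · exact le_max_right _ _
      _ = _ := by ring

/-- A polynomially bounded solution of `φ' = φ ^ (q + 1) • A`, with `A` of temperate growth, has
temperate growth. -/
theorem HasTemperateGrowth.of_hasFDerivAt_pow_smul {E : Type} [NormedAddCommGroup E]
    [NormedSpace ℝ E] {φ : E → ℂ} {A : E → E →L[ℝ] ℂ} {q : ℕ}
    (hφ : ∀ x, HasFDerivAt φ (φ x ^ (q + 1) • A x) x) (hA : A.HasTemperateGrowth)
    {k₀ : ℕ} {C₀ : ℝ} (hC₀ : ∀ x, ‖φ x‖ ≤ C₀ * (1 + ‖x‖) ^ k₀) : φ.HasTemperateGrowth := by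
  refine ⟨contDiff_of_hasFDerivAt_pow_smul hφ hA.1, fun n ↦ ?_⟩
  obtain ⟨k, C, h⟩ := exists_norm_iteratedFDeriv_pow_smul_le hφ hA hC₀ n (.const (1 : ℂ)) 0
  refine ⟨k + k₀, |C| * C₀, fun x ↦ ?_⟩
  have h' := h x
  simp only [zero_add, pow_one, smul_eq_mul, mul_one] at h'
  calc _ ≤ _ := h'
    _ ≤ |C| * (1 + ‖x‖) ^ k * (C₀ * (1 + ‖x‖) ^ k₀) := by
        gcongr
        · exact le_abs_self _
        · exact hC₀ x
    _ = _ := by rw [pow_add]; ring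

/-- The inverse of a function of temperate growth that is bounded away from zero has temperate
growth. -/
theorem HasTemperateGrowth.inv_of_le_norm {E : Type} [NormedAddCommGroup E]
    [NormedSpace ℝ E] {f : E → ℂ} (hf : f.HasTemperateGrowth) {c : ℝ} (hc : 0 < c)
    (h : ∀ x, c ≤ ‖f x‖) : (fun x ↦ (f x)⁻¹).HasTemperateGrowth := by
  refine .of_hasFDerivAt_pow_smul (q := 1) (A := fun x ↦ -_root_.fderiv ℝ f x) (k₀ := 0)
    (C₀ := c⁻¹) (fun x ↦ ?_) hf.fderiv.fun_neg fun x ↦ ?_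
  · have h0 : f x ≠ 0 := norm_pos_iff.1 (hc.trans_le (h x))
    have hd : HasFDerivAt f (_root_.fderiv ℝ f x) x :=
      (hf.1.differentiable (by simp) x).hasFDerivAt
    have hinv := (hasDerivAt_inv h0).comp_hasFDerivAt x hd
    have heq : (f x)⁻¹ ^ (1 + 1) • -_root_.fderiv ℝ f x =
        -(f x ^ 2)⁻¹ • _root_.fderiv ℝ f x := by
      ext v
      simp
    rw [heq]
    exact hinv
  · rw [norm_inv, pow_zero, mul_one]
    exact inv_anti₀ hc (h x)

/-- The exponential of a function of temperate growth with real part bounded above has temperate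
growth. -/
theorem HasTemperateGrowth.cexp {E : Type} [NormedAddCommGroup E]
    [NormedSpace ℝ E] {f : E → ℂ} (hf : f.HasTemperateGrowth) {c : ℝ}
    (h : ∀ x, (f x).re ≤ c) : (fun x ↦ Complex.exp (f x)).HasTemperateGrowth := by
  refine .of_hasFDerivAt_pow_smul (q := 0) (A := _root_.fderiv ℝ f) (k₀ := 0)
    (C₀ := Real.exp c) (fun x ↦ ?_) hf.fderiv fun x ↦ ?_
  · simpa using (hf.1.differentiable (by simp) x).hasFDerivAt.cexp
  · simpa [Complex.norm_exp] using h x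

/-- All derivatives of `exp (-w) • G`, with `w` and `G` of temperate growth and `w` growing at
least linearly, decay rapidly. -/
theorem HasTemperateGrowth.exists_schwartzMap_cexp_neg_smul {E F : Type} [NormedAddCommGroup E]
    [NormedSpace ℝ E] [NormedAddCommGroup F] [NormedSpace ℂ F] {w : E → ℂ} {G : E → F}
    (hw : w.HasTemperateGrowth) (hG : G.HasTemperateGrowth) {c : ℝ} (hc : 0 < c)
    (h : ∀ x, c * ‖x‖ ≤ (w x).re) :
    ∃ g : SchwartzMap E F, ∀ x, g x = Complex.exp (-w x) • G x := by
  have hbound : ∀ x, (-w x).re ≤ 0 := fun x ↦ by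
    have := h x
    have : 0 ≤ c * ‖x‖ := by positivity
    simp only [Complex.neg_re]
    linarith
  refine ⟨⟨_, (hw.fun_neg.cexp hbound).1.smul hG.1, fun p n ↦ ?_⟩, fun x ↦ rfl⟩
  obtain ⟨k, C, hC⟩ := exists_norm_iteratedFDeriv_pow_smul_le (q := 0) (k₀ := 0) (C₀ := 1)
    (φ := fun x ↦ Complex.exp (-w x)) (A := _root_.fderiv ℝ fun x ↦ -w x)
    (fun x ↦ by simpa using (hw.fun_neg.1.differentiable (by simp) x).hasFDerivAt.cexp)
    hw.fun_neg.fderiv (fun x ↦ by simpa [Complex.norm_exp] using hbound x) n hG 0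
  simp only [zero_add, pow_one, Complex.norm_exp] at hC
  refine ⟨|C| * ((p + k).factorial / c ^ (p + k) * Real.exp c), fun x ↦ ?_⟩
  have key : (1 + ‖x‖) ^ (p + k) * Real.exp (-w x).re ≤
      (p + k).factorial / c ^ (p + k) * Real.exp c := by
    have h1 := Real.pow_div_factorial_le_exp (c * (1 + ‖x‖)) (by positivity) (p + k)
    have h2 : Real.exp (-w x).re ≤ Real.exp c * Real.exp (-(c * (1 + ‖x‖))) := by
      rw [← Real.exp_add]
      gcongr
      have := h x
      simp only [Complex.neg_re]
      linarith
    have h3 : (1 + ‖x‖) ^ (p + k) ≤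
        (p + k).factorial / c ^ (p + k) * Real.exp (c * (1 + ‖x‖)) := by
      rw [div_le_iff₀ (by positivity), mul_pow] at h1
      rw [div_mul_eq_mul_div, le_div_iff₀ (by positivity)]
      linarith
    calc _ ≤ (p + k).factorial / c ^ (p + k) * Real.exp (c * (1 + ‖x‖)) *
          (Real.exp c * Real.exp (-(c * (1 + ‖x‖)))) := by gcongr
      _ = (p + k).factorial / c ^ (p + k) * Real.exp c *
          (Real.exp (c * (1 + ‖x‖)) * Real.exp (-(c * (1 + ‖x‖)))) := by ring
      _ = _ := by rw [← Real.exp_add, add_neg_cancel, Real.exp_zero, mul_one]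
  calc _ ≤ (1 + ‖x‖) ^ p * (|C| * (1 + ‖x‖) ^ k * Real.exp (-w x).re) := by
        gcongr
        · simp
        · refine (hC x).trans ?_
          gcongr
          exact le_abs_self _
    _ = |C| * ((1 + ‖x‖) ^ (p + k) * Real.exp (-w x).re) := by rw [pow_add]; ring
    _ ≤ _ := by gcongr

/-- The relativistic energy `x ↦ √(‖x‖ ^ 2 + m ^ 2)` has temperate growth. -/
theorem hasTemperateGrowth_sqrt_norm_sq_add_sq {E : Type*} [NormedAddCommGroup E]
    [InnerProductSpace ℝ E] {m : ℝ} (hm : 0 < m) :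
    (fun x : E ↦ √(‖x‖ ^ 2 + m ^ 2)).HasTemperateGrowth := by
  have h : (fun x : E ↦ √(‖x‖ ^ 2 + m ^ 2)) =
      fun x : E ↦ m * (1 + ‖m⁻¹ • x‖ ^ 2) ^ (1 / 2 : ℝ) := by
    ext x
    rw [← Real.sqrt_eq_rpow, norm_smul, norm_inv, Real.norm_of_nonneg hm.le]
    have h : ‖x‖ ^ 2 + m ^ 2 = m ^ 2 * (1 + (m⁻¹ * ‖x‖) ^ 2) := by
      field_simp
      ring
    rw [h, Real.sqrt_mul (sq_nonneg m), Real.sqrt_sq hm.le]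
  rw [h]
  exact (HasTemperateGrowth.const m).fun_mul
    ((hasTemperateGrowth_one_add_norm_sq_rpow E (1 / 2)).comp
      (m⁻¹ • ContinuousLinearMap.id ℝ E).hasTemperateGrowth)

end Function

open FourierTransform in
/-- The Fourier-type integral `x ↦ ∫ f k exp (i ⟪k, x⟫) dk` of a Schwartz function is a Schwartz
function. -/
theorem SchwartzMap.exists_eq_integral_mul_cexp_inner {V : Type*} [NormedAddCommGroup V]
    [InnerProductSpace ℝ V] [FiniteDimensional ℝ V] [MeasurableSpace V] [BorelSpace V]
    (f : SchwartzMap V ℂ) :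
    ∃ g : SchwartzMap V ℂ, ∀ x, g x = ∫ k, f k * Complex.exp (Complex.I * (⟪k, x⟫ : ℝ)) := by
  have hpi : (2 * Real.pi)⁻¹ ≠ 0 := by positivity
  refine ⟨SchwartzMap.compCLMOfContinuousLinearEquiv ℂ
    (ContinuousLinearEquiv.smulLeft (Units.mk0 _ hpi)) (𝓕⁻ f), fun x ↦ ?_⟩
  rw [SchwartzMap.compCLMOfContinuousLinearEquiv_apply, Function.comp_apply,
    SchwartzMap.fourierInv_coe, Real.fourierInv_eq']
  refine integral_congr_ae (.of_forall fun k ↦ ?_)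
  have h : 2 * Real.pi * ⟪k, (2 * Real.pi)⁻¹ • x⟫ = ⟪k, x⟫ := by
    rw [real_inner_smul_right]
    field_simp
  simp only [smul_eq_mul]
  rw [mul_comm, mul_comm Complex.I]
  congr 4

/-- For `m > 0` and `β > 0` and every fixed `t ∈ ℝ`, the spatial slice
`x ↦ G_mat(t,x)` of the matter piece is a Schwartz function `ℝ³ → ℂ`: there is a
Schwartz map agreeing with it at every `x`. -/
theorem matter_piece_spatial_slice_schwartz (m β : ℝ) (hm : 0 < m) (hβ : 0 < β) :
    ∀ t : ℝ, ∃ g : SchwartzMap (EuclideanSpace ℝ (Fin 3)) ℂ,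
      ∀ x : EuclideanSpace ℝ (Fin 3),
        g x = ∫ k : EuclideanSpace ℝ (Fin 3),
          (((1 / (Real.exp (β * Real.sqrt (‖k‖ ^ 2 + m ^ 2)) - 1)) /
              (2 * Real.sqrt (‖k‖ ^ 2 + m ^ 2)) : ℝ) : ℂ) *
            Complex.exp (-Complex.I * ((Real.sqrt (‖k‖ ^ 2 + m ^ 2) * t - ⟪k, x⟫ : ℝ) : ℂ)) := by
  intro t
  let energy : EuclideanSpace ℝ (Fin 3) → ℝ := fun k ↦ √(‖k‖ ^ 2 + m ^ 2)
  have hE_norm : ∀ k, ‖k‖ ≤ energy k := fun k ↦ Real.le_sqrt_of_sq_le (by nlinarith)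
  have hE_mass : ∀ k, m ≤ energy k := fun k ↦ Real.le_sqrt_of_sq_le (by nlinarith [sq_nonneg ‖k‖])
  have hE : (fun k ↦ (energy k : ℂ)).HasTemperateGrowth :=
    Function.Complex.hasTemperateGrowth_ofReal.comp
      (Function.hasTemperateGrowth_sqrt_norm_sq_add_sq hm)
  have hβE : (fun k ↦ (β : ℂ) * energy k).HasTemperateGrowth := .fun_mul (.const _) hE
  have hβE_mass : ∀ k, β * m ≤ β * energy k := fun k ↦ mul_le_mul_of_nonneg_left (hE_mass k) hβ.le
  have hβm : 0 < β * m := mul_pos hβ hm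
  have hu : (fun k ↦ 1 - Complex.exp (-(β * energy k))).HasTemperateGrowth :=
    .fun_sub (.const 1) (hβE.fun_neg.cexp (c := 0) fun k ↦ by
      have := hβE_mass k
      rw [← Complex.ofReal_mul, ← Complex.ofReal_neg, Complex.ofReal_re]
      linarith)
  have hu_inv : (fun k ↦ (1 - Complex.exp (-(β * energy k)))⁻¹).HasTemperateGrowth := by
    refine hu.inv_of_le_norm (c := 1 - Real.exp (-(β * m))) (by simpa using hβm) fun k ↦ ?_
    have h1 : 1 - Real.exp (-(β * m)) ≤ 1 - Real.exp (-(β * energy k)) := by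
      gcongr
      exact hE_mass k
    have h2 := h1.trans (Real.le_norm_self _)
    rw [← Complex.norm_real] at h2
    simpa using h2
  have hE_inv : (fun k ↦ (2 * energy k : ℂ)⁻¹).HasTemperateGrowth := by
    refine (Function.HasTemperateGrowth.fun_mul (.const 2) hE).inv_of_le_norm hm fun k ↦ ?_
    rw [norm_mul, Complex.norm_real, Real.norm_of_nonneg (hm.le.trans (hE_mass k))]
    have := hE_mass k
    simp only [Complex.norm_ofNat]
    linarith
  have hphase : (fun k ↦ Complex.exp (-Complex.I * t * energy k)).HasTemperateGrowth :=
    (Function.HasTemperateGrowth.fun_mul (.const (-Complex.I * t)) hE).cexp (c := 0) (by simp)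
  obtain ⟨f, hf⟩ := hβE.exists_schwartzMap_cexp_neg_smul
    ((hu_inv.fun_mul hE_inv).fun_mul hphase) hβ fun k ↦ by
      rw [← Complex.ofReal_mul, Complex.ofReal_re]
      exact mul_le_mul_of_nonneg_left (hE_norm k) hβ.le
  obtain ⟨g, hg⟩ := f.exists_eq_integral_mul_cexp_inner
  refine ⟨g, fun x ↦ ?_⟩
  rw [hg]
  refine integral_congr_ae (.of_forall fun k ↦ ?_)
  have hexp : (Complex.exp (β * energy k) - 1)⁻¹ =
      Complex.exp (-(β * energy k)) * (1 - Complex.exp (-(β * energy k)))⁻¹ := by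
    rw [Complex.exp_neg, ← mul_inv, mul_sub, mul_one, mul_inv_cancel₀ (Complex.exp_ne_zero _)]
  have hsplit : Complex.exp (-Complex.I * ((energy k * t - ⟪k, x⟫ : ℝ) : ℂ)) =
      Complex.exp (-Complex.I * t * energy k) * Complex.exp (Complex.I * (⟪k, x⟫ : ℝ)) := by
    rw [← Complex.exp_add]
    congr 1
    push_cast
    ring
  change f k * _ = ((1 / (Real.exp (β * energy k) - 1) / (2 * energy k) : ℝ) : ℂ) *
    Complex.exp (-Complex.I * ((energy k * t - ⟪k, x⟫ : ℝ) : ℂ))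
  rw [hf, hsplit]
  push_cast
  rw [one_div, hexp, smul_eq_mul]
  ring
end

section
/- Fix m > 0, β > 0 and x ∈ ℝ³. The matter piece extends holomorphically in complex time: for every complex z with Im z < β the integrand k ↦ (N(ω(k)) / (2 ω(k))) · exp(−i(ω(k) z − ⟨k, x⟩)) is Lebesgue integrable on ℝ³, and the function F(z) = ∫_{ℝ³} (N(ω(k)) / (2 ω(k))) · exp(−i(ω(k) z − ⟨k, x⟩)) dk is complex differentiable (holomorphic) on the open half-plane {z ∈ ℂ : Im z < β}. -/
open MeasureTheory RealInnerProductSpace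

open Module in
theorem integrable_exp_neg_mul_norm {E : Type*} [NormedAddCommGroup E] [NormedSpace ℝ E]
    [FiniteDimensional ℝ E] [MeasurableSpace E] [BorelSpace E] (μ : Measure E)
    [μ.IsAddHaarMeasure] {a : ℝ} (ha : 0 < a) :
    Integrable (fun k : E => Real.exp (-(a * ‖k‖))) μ := by
  set n := finrank ℝ E + 1 with hn
  have hr : (finrank ℝ E : ℝ) < (n : ℝ) := by rw [hn]; push_cast; linarith
  refine ((integrable_one_add_norm (μ := μ) hr).const_mul
    (Real.exp a * (n.factorial / a ^ n))).mono' (by fun_prop) (ae_of_all _ fun k => ?_)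
  have hk : 0 < 1 + ‖k‖ := by positivity
  have h := Real.pow_div_factorial_le_exp (a * (1 + ‖k‖)) (by positivity) n
  rw [Real.norm_of_nonneg (Real.exp_nonneg _), Real.rpow_neg hk.le, Real.rpow_natCast]
  have hexp : Real.exp (-(a * ‖k‖)) = Real.exp a * (Real.exp (a * (1 + ‖k‖)))⁻¹ := by
    rw [← Real.exp_neg, ← Real.exp_add]
    ring_nf
  rw [hexp, mul_assoc]
  gcongr
  calc (Real.exp (a * (1 + ‖k‖)))⁻¹ ≤ ((a * (1 + ‖k‖)) ^ n / n.factorial)⁻¹ := by gcongr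
    _ = n.factorial / a ^ n * ((1 + ‖k‖) ^ n)⁻¹ := by
      rw [mul_pow]
      field_simp

theorem norm_le_sqrt_norm_sq_add_sq {E : Type*} [SeminormedAddCommGroup E] (m : ℝ) (k : E) :
    ‖k‖ ≤ Real.sqrt (‖k‖ ^ 2 + m ^ 2) :=
  Real.le_sqrt_of_sq_le (by nlinarith [sq_nonneg m])

theorem le_sqrt_norm_sq_add_sq {E : Type*} [SeminormedAddCommGroup E] (m : ℝ) (k : E) :
    m ≤ Real.sqrt (‖k‖ ^ 2 + m ^ 2) :=
  Real.le_sqrt_of_sq_le (by nlinarith [sq_nonneg ‖k‖])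

theorem integrable_exp_neg_mul_sqrt_norm_sq_add_sq {E : Type*} [NormedAddCommGroup E]
    [NormedSpace ℝ E] [FiniteDimensional ℝ E] [MeasurableSpace E] [BorelSpace E] (μ : Measure E)
    [μ.IsAddHaarMeasure] (m : ℝ) {a : ℝ} (ha : 0 < a) :
    Integrable (fun k : E => Real.exp (-(a * Real.sqrt (‖k‖ ^ 2 + m ^ 2)))) μ := by
  refine (integrable_exp_neg_mul_norm μ ha).mono' (by fun_prop) (ae_of_all _ fun k => ?_)
  rw [Real.norm_of_nonneg (Real.exp_nonneg _)]
  gcongr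
  exact norm_le_sqrt_norm_sq_add_sq m k

theorem one_div_exp_mul_sub_one_le {m β w : ℝ} (hm : 0 < m) (hβ : 0 < β) (hw : m ≤ w) :
    1 / (Real.exp (β * w) - 1) ≤ (1 - Real.exp (-(β * m)))⁻¹ * Real.exp (-(β * w)) := by
  have hc : 0 < 1 - Real.exp (-(β * m)) := by
    rw [sub_pos, Real.exp_lt_one_iff]
    nlinarith [mul_pos hβ hm]
  rw [Real.exp_neg (β * w), ← mul_inv, one_div]
  refine inv_anti₀ (by positivity) ?_
  have h : 1 ≤ Real.exp (-(β * m)) * Real.exp (β * w) := by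
    rw [← Real.exp_add, Real.one_le_exp_iff]
    nlinarith [mul_le_mul_of_nonneg_left hw hβ.le]
  linarith

theorem norm_exp_neg_I_mul_sub (w t : ℝ) (z : ℂ) :
    ‖Complex.exp (-Complex.I * ((w : ℂ) * z - (t : ℂ)))‖ = Real.exp (w * z.im) := by
  simp [Complex.norm_exp]

/-- The thermal amplitude times `w` decays exponentially on each half-plane `Im z ≤ b < β`. -/
theorem norm_thermal_amplitude_mul_le {m β b w t : ℝ} (hm : 0 < m) (hβ : 0 < β) (hw : m ≤ w)
    {z : ℂ} (hz : z.im ≤ b) :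
    ‖(((1 / (Real.exp (β * w) - 1)) / (2 * w) : ℝ) : ℂ) *
        Complex.exp (-Complex.I * ((w : ℂ) * z - (t : ℂ)))‖ * w ≤
      (1 - Real.exp (-(β * m)))⁻¹ / 2 * Real.exp (-((β - b) * w)) := by
  have hw0 : 0 < w := hm.trans_le hw
  have hexp : 0 < Real.exp (β * w) - 1 := by
    rw [sub_pos, Real.one_lt_exp_iff]
    positivity
  rw [norm_mul, norm_exp_neg_I_mul_sub, Complex.norm_real,
    Real.norm_of_nonneg (by positivity)]
  calc 1 / (Real.exp (β * w) - 1) / (2 * w) * Real.exp (w * z.im) * w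
      = 1 / (Real.exp (β * w) - 1) * Real.exp (w * z.im) / 2 := by field_simp
    _ ≤ (1 - Real.exp (-(β * m)))⁻¹ * Real.exp (-(β * w)) * Real.exp (w * b) / 2 := by
      have h := one_div_exp_mul_sub_one_le hm hβ hw
      have := (one_div_pos.2 hexp).le.trans h
      gcongr
    _ = (1 - Real.exp (-(β * m)))⁻¹ / 2 * Real.exp (-((β - b) * w)) := by
      rw [mul_assoc, ← Real.exp_add]
      ring_nf

theorem continuous_thermal_integrand {m β : ℝ} (hm : 0 < m) (hβ : 0 < β)
    (x : EuclideanSpace ℝ (Fin 3)) (z : ℂ) :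
    Continuous (fun k : EuclideanSpace ℝ (Fin 3) =>
      (((1 / (Real.exp (β * Real.sqrt (‖k‖ ^ 2 + m ^ 2)) - 1)) /
          (2 * Real.sqrt (‖k‖ ^ 2 + m ^ 2)) : ℝ) : ℂ) *
        Complex.exp (-Complex.I *
          ((Real.sqrt (‖k‖ ^ 2 + m ^ 2) : ℂ) * z - ((⟪k, x⟫ : ℝ) : ℂ)))) := by
  have hpos (k : EuclideanSpace ℝ (Fin 3)) : 0 < Real.sqrt (‖k‖ ^ 2 + m ^ 2) :=
    hm.trans_le (le_sqrt_norm_sq_add_sq m k)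
  refine (Complex.continuous_ofReal.comp (Continuous.div (Continuous.div continuous_const
    (by fun_prop) fun k => ?_) (by fun_prop) fun k => ?_)).mul (by fun_prop)
  · have := Real.one_lt_exp_iff.2 (mul_pos hβ (hpos k))
    linarith
  · have := hpos k
    positivity

theorem integrable_thermal_integrand {m β : ℝ} (hm : 0 < m) (hβ : 0 < β)
    (x : EuclideanSpace ℝ (Fin 3)) {z : ℂ} (hz : z.im < β) :
    Integrable (fun k : EuclideanSpace ℝ (Fin 3) =>
      (((1 / (Real.exp (β * Real.sqrt (‖k‖ ^ 2 + m ^ 2)) - 1)) /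
          (2 * Real.sqrt (‖k‖ ^ 2 + m ^ 2)) : ℝ) : ℂ) *
        Complex.exp (-Complex.I *
          ((Real.sqrt (‖k‖ ^ 2 + m ^ 2) : ℂ) * z - ((⟪k, x⟫ : ℝ) : ℂ)))) := by
  refine (((integrable_exp_neg_mul_sqrt_norm_sq_add_sq volume m (sub_pos.2 hz)).const_mul
    ((1 - Real.exp (-(β * m)))⁻¹ / 2)).div_const m).mono'
    (continuous_thermal_integrand hm hβ x z).aestronglyMeasurable (ae_of_all _ fun k => ?_)
  rw [le_div_iff₀ hm]
  refine le_trans ?_ (norm_thermal_amplitude_mul_le (t := ⟪k, x⟫) hm hβ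
    (le_sqrt_norm_sq_add_sq m k) le_rfl)
  gcongr
  exact le_sqrt_norm_sq_add_sq m k

/-- For `m > 0`, `β > 0` and fixed `x ∈ ℝ³`, the matter piece extends
holomorphically to complex time: for every `z ∈ ℂ` with `Im z < β` the integrand
`k ↦ (N(ω k)/(2 ω k)) exp(−i(ω k · z − ⟨k,x⟩))` is Lebesgue integrable on `ℝ³`, and
`F(z) = ∫ (N(ω k)/(2 ω k)) exp(−i(ω k · z − ⟨k,x⟩)) dk` is holomorphic on the open
half-plane `{z : Im z < β}`. -/
theorem matter_piece_holomorphic_in_complex_time (m β : ℝ) (hm : 0 < m) (hβ : 0 < β)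
    (x : EuclideanSpace ℝ (Fin 3)) :
    (∀ z : ℂ, z.im < β →
      Integrable (fun k : EuclideanSpace ℝ (Fin 3) =>
        (((1 / (Real.exp (β * Real.sqrt (‖k‖ ^ 2 + m ^ 2)) - 1)) /
            (2 * Real.sqrt (‖k‖ ^ 2 + m ^ 2)) : ℝ) : ℂ) *
          Complex.exp (-Complex.I *
            ((Real.sqrt (‖k‖ ^ 2 + m ^ 2) : ℂ) * z - ((⟪k, x⟫ : ℝ) : ℂ))))) ∧
    DifferentiableOn ℂ
      (fun z : ℂ => ∫ k : EuclideanSpace ℝ (Fin 3),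
        (((1 / (Real.exp (β * Real.sqrt (‖k‖ ^ 2 + m ^ 2)) - 1)) /
            (2 * Real.sqrt (‖k‖ ^ 2 + m ^ 2)) : ℝ) : ℂ) *
          Complex.exp (-Complex.I *
            ((Real.sqrt (‖k‖ ^ 2 + m ^ 2) : ℂ) * z - ((⟪k, x⟫ : ℝ) : ℂ))))
      {z : ℂ | z.im < β} := by
  refine ⟨fun z hz => integrable_thermal_integrand hm hβ x hz, fun z hz => ?_⟩
  obtain ⟨b, hzb, hbβ⟩ := exists_between (show z.im < β from hz)
  have hs : {w : ℂ | w.im < b} ∈ nhds z :=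
    (isOpen_lt Complex.continuous_im continuous_const).mem_nhds hzb
  refine (hasDerivAt_integral_of_dominated_loc_of_deriv_le
    (F' := fun (w : ℂ) (k : EuclideanSpace ℝ (Fin 3)) =>
      ((((1 / (Real.exp (β * Real.sqrt (‖k‖ ^ 2 + m ^ 2)) - 1)) /
          (2 * Real.sqrt (‖k‖ ^ 2 + m ^ 2)) : ℝ) : ℂ) *
        Complex.exp (-Complex.I *
          ((Real.sqrt (‖k‖ ^ 2 + m ^ 2) : ℂ) * w - ((⟪k, x⟫ : ℝ) : ℂ)))) *
        (-Complex.I * (Real.sqrt (‖k‖ ^ 2 + m ^ 2) : ℂ)))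
    (bound := fun k => (1 - Real.exp (-(β * m)))⁻¹ / 2 *
      Real.exp (-((β - b) * Real.sqrt (‖k‖ ^ 2 + m ^ 2)))) hs
    (.of_forall fun w => (continuous_thermal_integrand hm hβ x w).aestronglyMeasurable)
    (integrable_thermal_integrand hm hβ x hz)
    ((continuous_thermal_integrand hm hβ x z).mul (by fun_prop)).aestronglyMeasurable
    (ae_of_all _ fun k w hw => ?_)
    ((integrable_exp_neg_mul_sqrt_norm_sq_add_sq volume m (sub_pos.2 hbβ)).const_mul _)
    (ae_of_all _ fun k w _ => ?_)).2.differentiableAt.differentiableWithinAt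
  · rw [norm_mul, norm_mul (-Complex.I), norm_neg, Complex.norm_I, one_mul, Complex.norm_real,
      Real.norm_of_nonneg (Real.sqrt_nonneg _)]
    exact norm_thermal_amplitude_mul_le hm hβ (le_sqrt_norm_sq_add_sq m k) (le_of_lt hw)
  · rw [mul_assoc]
    refine HasDerivAt.const_mul _ (HasDerivAt.cexp ?_)
    simpa using (((hasDerivAt_id w).const_mul
      (Real.sqrt (‖k‖ ^ 2 + m ^ 2) : ℂ)).sub_const ((⟪k, x⟫ : ℝ) : ℂ)).const_mul (-Complex.I)
end

section
/- Fix m > 0 and β > 0 (the KMS condition for the positive-frequency part of the free thermal two-point function). For every t ∈ ℝ and x ∈ ℝ³, both integrands below are Lebesgue integrable on ℝ³ and ∫_{ℝ³} ((1 + N(ω(k))) / (2 ω(k))) · exp(−i ω(k) (t − iβ)) · exp(i⟨k, x⟩) dk = ∫_{ℝ³} (N(ω(k)) / (2 ω(k))) · exp(−i ω(k) t) · exp(i⟨k, x⟩) dk. -/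
open MeasureTheory RealInnerProductSpace

/-- Detailed balance: the Bose–Einstein occupation number satisfies `(1 + N) e^{-y} = N`. -/
lemma one_add_boseEinstein_mul_exp_neg {y : ℝ} (hy : y ≠ 0) :
    (1 + 1 / (Real.exp y - 1)) * Real.exp (-y) = 1 / (Real.exp y - 1) := by
  have h : Real.exp y - 1 ≠ 0 := sub_ne_zero.mpr (by simpa using hy)
  rw [Real.exp_neg]
  field_simp
  ring

/-- The Bose–Einstein occupation number decays faster than the fourth power. -/
lemma boseEinstein_le_div_pow_four {y : ℝ} (hy : 0 < y) :
    1 / (Real.exp y - 1) ≤ 24 / y ^ 4 := by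
  have h := Real.sum_le_exp_of_nonneg hy.le 5
  simp only [Finset.sum_range_succ, Finset.sum_range_zero, Nat.factorial] at h
  norm_num at h
  have h1 : y ^ 4 / 24 ≤ Real.exp y - 1 := by
    have : 0 < y ^ 2 := by positivity
    have : 0 < y ^ 3 := by positivity
    linarith
  calc 1 / (Real.exp y - 1) ≤ 1 / (y ^ 4 / 24) :=
        one_div_le_one_div_of_le (by positivity) h1
    _ = 24 / y ^ 4 := one_div_div _ _

lemma one_add_le_const_mul_sqrt_sq_add_sq {m : ℝ} (hm : 0 < m) (r : ℝ) :
    1 + r ≤ (1 + 1 / m) * Real.sqrt (r ^ 2 + m ^ 2) := by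
  have h1 : r ≤ Real.sqrt (r ^ 2 + m ^ 2) := Real.le_sqrt_of_sq_le (by nlinarith)
  have h2 : m ≤ Real.sqrt (r ^ 2 + m ^ 2) := Real.le_sqrt_of_sq_le (by nlinarith)
  have h3 : 1 ≤ 1 / m * Real.sqrt (r ^ 2 + m ^ 2) := by
    rwa [one_div_mul_eq_div, one_le_div hm]
  linarith

/-- The thermal weight `N(ω(k)) / (2 ω(k))` is Lebesgue integrable on `ℝ³`. -/
lemma integrable_boseEinstein_div_energy {m β : ℝ} (hm : 0 < m) (hβ : 0 < β) :
    Integrable (fun k : EuclideanSpace ℝ (Fin 3) =>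
      (1 / (Real.exp (β * Real.sqrt (‖k‖ ^ 2 + m ^ 2)) - 1)) /
        (2 * Real.sqrt (‖k‖ ^ 2 + m ^ 2))) := by
  have hbase : Integrable (fun k : EuclideanSpace ℝ (Fin 3) => (1 + ‖k‖) ^ (-4 : ℝ)) :=
    integrable_one_add_norm (by rw [finrank_euclideanSpace_fin]; norm_num)
  refine (hbase.const_mul (24 * (1 + 1 / m) ^ 4 / β ^ 4 / (2 * m))).mono'
    (Measurable.aestronglyMeasurable (by fun_prop)) (.of_forall fun k => ?_)
  have hbound := one_add_le_const_mul_sqrt_sq_add_sq hm ‖k‖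
  have hmω : m ≤ Real.sqrt (‖k‖ ^ 2 + m ^ 2) := Real.le_sqrt_of_sq_le (by nlinarith)
  set ω := Real.sqrt (‖k‖ ^ 2 + m ^ 2)
  have hω : 0 < ω := hm.trans_le hmω
  have hN : 0 < Real.exp (β * ω) - 1 := sub_pos.mpr (Real.one_lt_exp_iff.mpr (by positivity))
  have hk : 0 < 1 + ‖k‖ := by positivity
  rw [Real.norm_of_nonneg (by positivity), Real.rpow_neg hk.le]
  norm_cast
  calc 1 / (Real.exp (β * ω) - 1) / (2 * ω)
      ≤ 24 / (β * ω) ^ 4 / (2 * m) := by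
        have := boseEinstein_le_div_pow_four (mul_pos hβ hω)
        exact div_le_div₀ (by positivity) this (by positivity) (by linarith)
    _ = 24 * (1 + 1 / m) ^ 4 / β ^ 4 / (2 * m) * (((1 + 1 / m) * ω) ^ 4)⁻¹ := by
        field_simp
    _ ≤ 24 * (1 + 1 / m) ^ 4 / β ^ 4 / (2 * m) * ((1 + ‖k‖) ^ 4)⁻¹ := by
        gcongr

/-- KMS condition for the positive-frequency part of the free thermal
two-point function. For `m > 0`, `β > 0`, `t ∈ ℝ`, `x ∈ ℝ³`, both integrands are
Lebesgue integrable on `ℝ³` and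
`∫ ((1 + N(ω k))/(2 ω k)) exp(−i ω k (t − iβ)) exp(i⟨k,x⟩) dk
  = ∫ (N(ω k)/(2 ω k)) exp(−i ω k t) exp(i⟨k,x⟩) dk`. -/
theorem thermal_two_point_KMS (m β : ℝ) (hm : 0 < m) (hβ : 0 < β)
    (t : ℝ) (x : EuclideanSpace ℝ (Fin 3)) :
    Integrable (fun k : EuclideanSpace ℝ (Fin 3) =>
      (((1 + 1 / (Real.exp (β * Real.sqrt (‖k‖ ^ 2 + m ^ 2)) - 1)) /
          (2 * Real.sqrt (‖k‖ ^ 2 + m ^ 2)) : ℝ) : ℂ) *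
        Complex.exp (-Complex.I * (Real.sqrt (‖k‖ ^ 2 + m ^ 2) : ℂ) *
          ((t : ℂ) - Complex.I * (β : ℂ))) *
        Complex.exp (Complex.I * ((⟪k, x⟫ : ℝ) : ℂ))) ∧
    Integrable (fun k : EuclideanSpace ℝ (Fin 3) =>
      (((1 / (Real.exp (β * Real.sqrt (‖k‖ ^ 2 + m ^ 2)) - 1)) /
          (2 * Real.sqrt (‖k‖ ^ 2 + m ^ 2)) : ℝ) : ℂ) *
        Complex.exp (-Complex.I * (Real.sqrt (‖k‖ ^ 2 + m ^ 2) : ℂ) * (t : ℂ)) *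
        Complex.exp (Complex.I * ((⟪k, x⟫ : ℝ) : ℂ))) ∧
    (∫ k : EuclideanSpace ℝ (Fin 3),
      (((1 + 1 / (Real.exp (β * Real.sqrt (‖k‖ ^ 2 + m ^ 2)) - 1)) /
          (2 * Real.sqrt (‖k‖ ^ 2 + m ^ 2)) : ℝ) : ℂ) *
        Complex.exp (-Complex.I * (Real.sqrt (‖k‖ ^ 2 + m ^ 2) : ℂ) *
          ((t : ℂ) - Complex.I * (β : ℂ))) *
        Complex.exp (Complex.I * ((⟪k, x⟫ : ℝ) : ℂ))) =
    (∫ k : EuclideanSpace ℝ (Fin 3),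
      (((1 / (Real.exp (β * Real.sqrt (‖k‖ ^ 2 + m ^ 2)) - 1)) /
          (2 * Real.sqrt (‖k‖ ^ 2 + m ^ 2)) : ℝ) : ℂ) *
        Complex.exp (-Complex.I * (Real.sqrt (‖k‖ ^ 2 + m ^ 2) : ℂ) * (t : ℂ)) *
        Complex.exp (Complex.I * ((⟪k, x⟫ : ℝ) : ℂ))) := by
  have hpt (k : EuclideanSpace ℝ (Fin 3)) :
      (((1 + 1 / (Real.exp (β * Real.sqrt (‖k‖ ^ 2 + m ^ 2)) - 1)) /
          (2 * Real.sqrt (‖k‖ ^ 2 + m ^ 2)) : ℝ) : ℂ) *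
        Complex.exp (-Complex.I * (Real.sqrt (‖k‖ ^ 2 + m ^ 2) : ℂ) *
          ((t : ℂ) - Complex.I * (β : ℂ))) *
        Complex.exp (Complex.I * ((⟪k, x⟫ : ℝ) : ℂ)) =
      (((1 / (Real.exp (β * Real.sqrt (‖k‖ ^ 2 + m ^ 2)) - 1)) /
          (2 * Real.sqrt (‖k‖ ^ 2 + m ^ 2)) : ℝ) : ℂ) *
        Complex.exp (-Complex.I * (Real.sqrt (‖k‖ ^ 2 + m ^ 2) : ℂ) * (t : ℂ)) *
        Complex.exp (Complex.I * ((⟪k, x⟫ : ℝ) : ℂ)) := by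
    have hω : 0 < Real.sqrt (‖k‖ ^ 2 + m ^ 2) := by positivity
    set ω := Real.sqrt (‖k‖ ^ 2 + m ^ 2)
    have hexp : Complex.exp (-Complex.I * (ω : ℂ) * ((t : ℂ) - Complex.I * (β : ℂ))) =
        ((Real.exp (-(β * ω)) : ℝ) : ℂ) * Complex.exp (-Complex.I * (ω : ℂ) * (t : ℂ)) := by
      rw [Complex.ofReal_exp, ← Complex.exp_add]
      congr 1
      push_cast
      linear_combination (ω * β : ℂ) * Complex.I_sq
    rw [hexp, ← mul_assoc, ← Complex.ofReal_mul, div_mul_eq_mul_div,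
      one_add_boseEinstein_mul_exp_neg (mul_pos hβ hω).ne']
  have hint : Integrable (fun k : EuclideanSpace ℝ (Fin 3) =>
      (((1 / (Real.exp (β * Real.sqrt (‖k‖ ^ 2 + m ^ 2)) - 1)) /
          (2 * Real.sqrt (‖k‖ ^ 2 + m ^ 2)) : ℝ) : ℂ) *
        Complex.exp (-Complex.I * (Real.sqrt (‖k‖ ^ 2 + m ^ 2) : ℂ) * (t : ℂ)) *
        Complex.exp (Complex.I * ((⟪k, x⟫ : ℝ) : ℂ))) := by
    refine (integrable_boseEinstein_div_energy hm hβ).mono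
      (Measurable.aestronglyMeasurable (by fun_prop)) (.of_forall fun k => ?_)
    rw [norm_mul, norm_mul, Complex.norm_real, Complex.norm_exp, Complex.norm_exp]
    simp
  exact ⟨hint.congr (.of_forall fun k => (hpt k).symm), hint,
    integral_congr_ae (.of_forall hpt)⟩
end
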